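/- Let p_n, q_n be sequences with p_n, q_n ≤ 2/3, p_n ≠ q_n for all n, and n p_n / log^3 n → ∞ and n q_n / log^3 n → ∞. Set σ_n = √(p_n(1−p_n) + q_n(1−q_n)). Then n · P(n, p_n, q_n) → 0 if and only if (√n σ_n / |p_n − q_n|) · exp(−n (p_n − q_n)^2 / (2 σ_n^2)) → 0. -/

import Mathlib

open Real Filter

/-- Probability that a Binomial(m, p) random variable equals `k`. -/
noncomputable def binomProb (m : ℕ) (p : ℝ) (k : ℕ) : ℝ :=
  (m.choose k : ℝ) * p ^ k * (1 - p) ^ (m - k)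

/-- For independent `X ~ Binomial(m, p)` and `Y ~ Binomial(n, q)`,
the probability `Pr(Y ≥ X - ℓ)`. -/
noncomputable def prGEshift (m : ℕ) (p : ℝ) (n : ℕ) (q : ℝ) (ℓ : ℝ) : ℝ :=
  ∑ j ∈ Finset.range (m + 1), ∑ k ∈ Finset.range (n + 1),
    if (j : ℝ) - ℓ ≤ (k : ℝ) then binomProb m p j * binomProb n q k else 0

/-- For independent `X ~ Binomial(m, p)` and `Y ~ Binomial(n, q)`,
the probability `Pr(Y ≥ X)`. -/
noncomputable def prGE (m : ℕ) (p : ℝ) (n : ℕ) (q : ℝ) : ℝ :=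
  prGEshift m p n q 0

/-- `P(m, n, p, q) = Pr(Y ≥ X)` for independent `X ~ Binomial(m, max p q)`
and `Y ~ Binomial(n, min p q)`. -/
noncomputable def Pmn (m n : ℕ) (p q : ℝ) : ℝ :=
  prGE m (max p q) n (min p q)

/-- `P(n, p, q) = P(n, n, p, q)`. -/
noncomputable def Pn (n : ℕ) (p q : ℝ) : ℝ :=
  Pmn n n p q


lemma aux_binom_nonneg (n : ℕ) (r : ℝ) (h0 : 0 ≤ r) (h1 : r ≤ 1) (k : ℕ) : 0 ≤ binomProb n r k := by
  unfold binomProb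
  have : 0 ≤ 1 - r := by linarith
  positivity

lemma aux_binom_sum (n : ℕ) (r : ℝ) : ∑ k ∈ Finset.range (n + 1), binomProb n r k = 1 := by
  have h := congrArg (Polynomial.eval r) (bernsteinPolynomial.sum ℝ n)
  rw [Polynomial.eval_finsetSum] at h
  simpa [bernsteinPolynomial, binomProb] using h

lemma aux_binom_var (n : ℕ) (r : ℝ) :
    ∑ k ∈ Finset.range (n + 1), ((n : ℝ) * r - k) ^ 2 * binomProb n r k = n * r * (1 - r) := by
  have h := congrArg (Polynomial.eval r) (bernsteinPolynomial.variance ℝ n)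
  rw [Polynomial.eval_finsetSum] at h
  simpa [bernsteinPolynomial, binomProb] using h

lemma aux_binom_zero (n : ℕ) (r : ℝ) (k : ℕ) (h : n < k) : binomProb n r k = 0 := by
  simp [binomProb, Nat.choose_eq_zero_of_lt h]

lemma aux_binom_sum_le (n : ℕ) (r : ℝ) (h0 : 0 ≤ r) (h1 : r ≤ 1) (s : Finset ℕ) :
    ∑ k ∈ s, binomProb n r k ≤ 1 := by
  classical
  calc ∑ k ∈ s, binomProb n r k ≤ ∑ k ∈ s ∪ Finset.range (n + 1), binomProb n r k :=
        Finset.sum_le_sum_of_subset_of_nonneg Finset.subset_union_left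
          (fun i _ _ => aux_binom_nonneg n r h0 h1 i)
    _ = ∑ k ∈ Finset.range (n + 1), binomProb n r k := by
        symm
        apply Finset.sum_subset Finset.subset_union_right
        intro x _ hx
        apply aux_binom_zero
        simpa using hx
    _ = 1 := aux_binom_sum n r

lemma aux_binom_succ (n : ℕ) (r : ℝ) (k : ℕ) :
    ((k : ℝ) + 1) * (1 - r) * binomProb n r (k + 1) = ((n : ℝ) - k) * r * binomProb n r k := by
  rcases lt_trichotomy k n with h | h | h
  · have hc : ((n.choose (k + 1) : ℝ)) * (k + 1) = n.choose k * ((n : ℝ) - k) := by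
      have := Nat.choose_succ_right_eq n k
      rw [← Nat.cast_sub h.le]
      exact_mod_cast this
    have hpow : (1 - r) ^ (n - k) = (1 - r) ^ (n - (k + 1)) * (1 - r) := by
      rw [← pow_succ]; congr 1; omega
    unfold binomProb
    rw [hpow, pow_succ]
    linear_combination (r ^ k * r * (1 - r) ^ (n - (k + 1)) * (1 - r)) * hc
  · subst h
    rw [aux_binom_zero k r (k + 1) (by omega)]; simp
  · rw [aux_binom_zero n r (k + 1) (by omega), aux_binom_zero n r k h]; simp

lemma aux_binom_max (n : ℕ) (r : ℝ) (h0 : 0 < r) (h1 : r < 1)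
    (hv : 1 ≤ ((n : ℝ) + 1) * r * (1 - r)) (i : ℕ) :
    binomProb n r i ≤ 4 / √(((n : ℝ) + 1) * r * (1 - r)) := by
  set v := ((n : ℝ) + 1) * r * (1 - r) with hvdef
  have h1' : 0 < 1 - r := by linarith
  have hvpos : 0 < v := by linarith
  obtain ⟨k, hk, hmax⟩ := Finset.exists_max_image (Finset.range (n + 1)) (binomProb n r)
    ⟨0, by simp⟩
  have hkn : k ≤ n := by simpa [Nat.lt_succ_iff] using hk
  have hnn := aux_binom_nonneg n r h0.le h1.le
  have hbpos : 0 < binomProb n r k := by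
    unfold binomProb
    have := Nat.choose_pos hkn
    positivity
  have hmaxall : ∀ i, binomProb n r i ≤ binomProb n r k := by
    intro i
    by_cases hi : i ≤ n
    · exact hmax i (by simpa [Nat.lt_succ_iff] using hi)
    · rw [aux_binom_zero n r i (by omega)]; exact hnn k
  -- mode bound
  have hmode : (k : ℝ) * (1 - r) ≤ ((n : ℝ) - k + 1) * r := by
    rcases Nat.eq_zero_or_pos k with h | h
    · subst h
      have : (0 : ℝ) ≤ ((n : ℝ) + 1) * r := by positivity
      simp
      linarith
    · obtain ⟨l, rfl⟩ : ∃ l, k = l + 1 := ⟨k - 1, by omega⟩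
      have e := aux_binom_succ n r l
      have hl := hmaxall l
      have hln : (0 : ℝ) ≤ (n : ℝ) - l := by
        have : ((l + 1 : ℕ) : ℝ) ≤ n := by exact_mod_cast hkn
        push_cast at this; linarith
      have : ((l : ℝ) + 1) * (1 - r) * binomProb n r (l + 1)
          ≤ ((n : ℝ) - l) * r * binomProb n r (l + 1) := by
        rw [e]; gcongr
      have := le_of_mul_le_mul_right this hbpos
      push_cast; linarith
  have hN : v ≤ ((n : ℝ) - k + 1) * r := by
    have : ((n : ℝ) + 1) * (1 - r) ≤ (n : ℝ) - k + 1 := by linarith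
    calc v = ((n : ℝ) + 1) * (1 - r) * r := by rw [hvdef]; ring
      _ ≤ _ := by gcongr
  have hstep : ∀ j : ℕ, ((j : ℝ) + 1) ≤ v →
      (1 - ((j : ℝ) + 1) / v) * binomProb n r (k + j) ≤ binomProb n r (k + j + 1) := by
    intro j hj
    have e := aux_binom_succ n r (k + j)
    push_cast at e
    have hD : 0 < ((k : ℝ) + j + 1) * (1 - r) := by positivity
    have hw : 0 ≤ 1 - ((j : ℝ) + 1) / v := by
      rw [sub_nonneg, div_le_one hvpos]; exact hj
    have key : (1 - ((j : ℝ) + 1) / v) * (((k : ℝ) + j + 1) * (1 - r)) ≤ ((n : ℝ) - (k + j)) * r := by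
      set N := ((n : ℝ) - k + 1) * r with hNdef
      have hD2 : ((k : ℝ) + j + 1) * (1 - r) ≤ N + (j + 1) * (1 - r) := by nlinarith
      have h3 : (j : ℝ) + 1 ≤ ((j : ℝ) + 1) / v * N := by
        rw [div_mul_eq_mul_div, le_div_iff₀ hvpos]
        have : (0 : ℝ) ≤ (j : ℝ) + 1 := by positivity
        nlinarith
      have h4 : 0 ≤ ((j : ℝ) + 1) / v * ((j + 1) * (1 - r)) := by positivity
      calc _ ≤ (1 - ((j : ℝ) + 1) / v) * (N + (j + 1) * (1 - r)) := by gcongr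
        _ ≤ N - (j + 1) * r := by nlinarith
        _ = _ := by rw [hNdef]; ring
    have hb := hnn (k + j)
    have : ((k : ℝ) + j + 1) * (1 - r) * ((1 - ((j : ℝ) + 1) / v) * binomProb n r (k + j)) ≤
        ((k : ℝ) + j + 1) * (1 - r) * binomProb n r (k + j + 1) := by
      rw [e]
      nlinarith [mul_le_mul_of_nonneg_right key hb]
    exact le_of_mul_le_mul_left this hD
  have hind : ∀ j : ℕ, (j : ℝ) * (j + 1) ≤ v →
      (1 - (j : ℝ) * (j + 1) / (2 * v)) * binomProb n r k ≤ binomProb n r (k + j) := by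
    intro j
    induction j with
    | zero => intro _; simp
    | succ j ih =>
      intro hj
      push_cast at hj ⊢
      have hj0 : (0 : ℝ) ≤ j := by positivity
      have ih' := ih (by nlinarith)
      have hj1 : (j : ℝ) + 1 ≤ v := by nlinarith
      have hs := hstep j hj1
      have hw : 0 ≤ 1 - ((j : ℝ) + 1) / v := by
        rw [sub_nonneg, div_le_one hvpos]; exact hj1
      have h5 : (1 - ((j : ℝ) + 1) / v) * ((1 - (j : ℝ) * (j + 1) / (2 * v)) * binomProb n r k)
        ≤ binomProb n r (k + j + 1) := le_trans (by gcongr) hs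
      refine le_trans ?_ h5
      rw [← mul_assoc (1 - ((j : ℝ) + 1) / v)]
      apply mul_le_mul_of_nonneg_right _ hbpos.le
      have h6 : ((j : ℝ) + 1) * (j + 1 + 1) / (2 * v) = ((j : ℝ) + 1) / v + (j : ℝ) * (j + 1) / (2 * v) := by
        field_simp; ring
      rw [h6]
      have h7 : 0 ≤ ((j : ℝ) + 1) / v * ((j : ℝ) * (j + 1) / (2 * v)) := by positivity
      nlinarith
  refine (hmaxall i).trans ?_
  have hsq1 : 1 ≤ √v := by rw [Real.one_le_sqrt]; exact hv
  set F := ⌊√v⌋₊ with hF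
  have hF1 : 1 ≤ F := Nat.le_floor (by simpa using hsq1)
  have hFle : (F : ℝ) ≤ √v := Nat.floor_le (by positivity)
  have hFlt : √v < F + 1 := Nat.lt_floor_add_one _
  have hF1' : (1 : ℝ) ≤ F := by exact_mod_cast hF1
  have hsum : ∑ j ∈ Finset.range F, binomProb n r (k + j) ≤ 1 := by
    have := aux_binom_sum_le n r h0.le h1.le ((Finset.range F).image (fun j => k + j))
    rwa [Finset.sum_image (by intro a _ b _ h; simpa using h)] at this
  have hlow : ∑ j ∈ Finset.range F, (1 / 2) * binomProb n r k ≤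
      ∑ j ∈ Finset.range F, binomProb n r (k + j) := by
    apply Finset.sum_le_sum
    intro j hj
    have hjF : j + 1 ≤ F := by simpa [Nat.succ_le_iff] using hj
    have hjF' : (j : ℝ) + 1 ≤ √v := le_trans (by exact_mod_cast hjF) hFle
    have hjv : (j : ℝ) * (j + 1) ≤ v := by
      have : √v * √v = v := Real.mul_self_sqrt hvpos.le
      have hj0 : (0 : ℝ) ≤ j := by positivity
      nlinarith
    refine le_trans ?_ (hind j hjv)
    apply mul_le_mul_of_nonneg_right _ hbpos.le
    have : (j : ℝ) * (j + 1) / (2 * v) ≤ 1 / 2 := by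
      rw [div_le_div_iff₀ (by positivity) (by norm_num)]; linarith
    linarith
  rw [Finset.sum_const, Finset.card_range, nsmul_eq_mul] at hlow
  rw [le_div_iff₀ (by linarith)]
  nlinarith

lemma aux_pairs_upper (n : ℕ) (r lam M : ℝ) (h0 : 0 ≤ r) (h1 : r ≤ 1) (hl0 : 0 ≤ lam) (hl1 : lam < 1)
    (hM0 : 0 ≤ M) (hM : ∀ k, binomProb n r k ≤ M) :
    ∑ j ∈ Finset.range (n + 1), ∑ k ∈ Finset.range (n + 1),
      (if j ≤ k then binomProb n r j * binomProb n r k * lam ^ (k - j) else 0) ≤ M / (1 - lam) := by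
  have hnn := aux_binom_nonneg n r h0 h1
  have hinner : ∀ j, ∑ k ∈ Finset.range (n + 1),
      (if j ≤ k then binomProb n r j * binomProb n r k * lam ^ (k - j) else 0) ≤
      binomProb n r j * (M / (1 - lam)) := by
    intro j
    rw [← Finset.sum_filter]
    calc _ ≤ ∑ k ∈ Finset.range (n + 1) with j ≤ k, binomProb n r j * M * lam ^ (k - j) := by
            apply Finset.sum_le_sum
            intro k _
            have := hnn j
            have := hM k
            gcongr
      _ = binomProb n r j * M * ∑ k ∈ Finset.range (n + 1) with j ≤ k, lam ^ (k - j) := by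
            rw [Finset.mul_sum]
      _ = binomProb n r j * M * ∑ d ∈ (Finset.filter (fun k => j ≤ k) (Finset.range (n + 1))).image
            (fun k => k - j), lam ^ d := by
            rw [Finset.sum_image]
            intro x hx y hy h
            simp at hx hy h
            omega
      _ ≤ binomProb n r j * M * (1 / (1 - lam)) := by
            have := hnn j
            gcongr
            rw [one_div, ← tsum_geometric_of_lt_one hl0 hl1]
            exact (summable_geometric_of_lt_one hl0 hl1).sum_le_tsum _ (fun i _ => by positivity)
      _ = _ := by ring
  calc _ ≤ ∑ j ∈ Finset.range (n + 1), binomProb n r j * (M / (1 - lam)) :=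
        Finset.sum_le_sum (fun j _ => hinner j)
    _ = _ := by rw [← Finset.sum_mul, aux_binom_sum, one_mul]

/-- mass near the mean -/
lemma aux_cheb (n : ℕ) (r : ℝ) (h0 : 0 < r) (h1 : r < 1) (s : ℝ) (hs : 0 < s)
    (hs2 : n * r * (1 - r) ≤ s ^ 2) :
    3 / 4 ≤ ∑ k ∈ Finset.range (n + 1) with |(n : ℝ) * r - (k : ℕ)| ≤ 2 * s, binomProb n r k := by
  have hnn := aux_binom_nonneg n r h0.le h1.le
  have hsplit := Finset.sum_filter_add_sum_filter_not (Finset.range (n + 1))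
    (fun k : ℕ => |(n : ℝ) * r - (k : ℕ)| ≤ 2 * s) (binomProb n r)
  rw [aux_binom_sum] at hsplit
  have hvar := aux_binom_var n r
  have : 4 * s ^ 2 * ∑ k ∈ Finset.range (n + 1) with ¬ |(n : ℝ) * r - (k : ℕ)| ≤ 2 * s, binomProb n r k
      ≤ n * r * (1 - r) := by
    rw [← hvar, Finset.mul_sum]
    calc _ ≤ ∑ k ∈ Finset.range (n + 1) with ¬ |(n : ℝ) * r - (k : ℕ)| ≤ 2 * s,
            ((n : ℝ) * r - k) ^ 2 * binomProb n r k := by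
          apply Finset.sum_le_sum
          intro k hk
          apply mul_le_mul_of_nonneg_right _ (hnn k)
          simp at hk
          rw [← sq_abs ((n : ℝ) * r - k)]
          nlinarith [hk.2]
      _ ≤ _ := Finset.sum_le_sum_of_subset_of_nonneg (Finset.filter_subset _ _)
          (fun i _ _ => mul_nonneg (sq_nonneg _) (hnn i))
  have h2 : 0 < s ^ 2 := by positivity
  nlinarith

lemma aux_cells (n : ℕ) (r : ℝ) (h0 : 0 < r) (h1 : r < 1) (s : ℝ) (hs : 0 < s)
    (hs2 : n * r * (1 - r) ≤ s ^ 2) (L : ℕ) :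
    (9 / 32) / (4 * s / (L + 1) + 2) ≤
    ∑ j ∈ Finset.range (n + 1), ∑ k ∈ Finset.range (n + 1),
      (if j ≤ k ∧ k ≤ j + L then binomProb n r j * binomProb n r k else 0) := by
  have hnn := aux_binom_nonneg n r h0.le h1.le
  set b := binomProb n r with hb
  set A := (Finset.range (n + 1)).filter (fun k : ℕ => |(n : ℝ) * r - (k : ℕ)| ≤ 2 * s) with hA
  have hcheb : 3 / 4 ≤ ∑ k ∈ A, b k := aux_cheb n r h0 h1 s hs hs2
  set c : ℕ → ℕ := fun k => k / (L + 1) with hc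
  have hmass : ∑ i ∈ A.image c, ∑ k ∈ A with c k = i, b k = ∑ k ∈ A, b k :=
    Finset.sum_fiberwise_of_maps_to (fun k hk => Finset.mem_image_of_mem c hk) _
  have hLpos : (0 : ℝ) < L + 1 := by positivity
  -- number of cells
  have hcard : ((A.image c).card : ℝ) ≤ 4 * s / (L + 1) + 2 := by
    by_cases hne : (A.image c).Nonempty
    · set lo := (A.image c).min' hne
      set hi := (A.image c).max' hne
      obtain ⟨x, hx, hxlo⟩ := Finset.mem_image.1 ((A.image c).min'_mem hne)
      obtain ⟨y, hy, hyhi⟩ := Finset.mem_image.1 ((A.image c).max'_mem hne)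
      have hsub : A.image c ⊆ Finset.Icc lo hi := fun z hz =>
        Finset.mem_Icc.2 ⟨Finset.min'_le _ _ hz, Finset.le_max' _ _ hz⟩
      have hcd := Finset.card_le_card hsub
      rw [Nat.card_Icc] at hcd
      have hlohi : lo ≤ hi := Finset.min'_le_max' _ hne
      have hcd' : ((A.image c).card : ℝ) ≤ (hi : ℝ) + 1 - lo := by
        have : ((A.image c).card : ℝ) ≤ ((hi + 1 - lo : ℕ) : ℝ) := by exact_mod_cast hcd
        rw [Nat.cast_sub (by omega)] at this
        push_cast at this; exact this
      have hx2 := (Finset.mem_filter.1 hx).2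
      have hy2 := (Finset.mem_filter.1 hy).2
      rw [abs_le] at hx2 hy2
      have hyx : (y : ℝ) - x ≤ 4 * s := by linarith [hx2.2, hy2.1, hx2.1, hy2.2]
      have e1 : (hi : ℝ) * (L + 1) ≤ y := by
        have : hi * (L + 1) ≤ y := by
          have : y / (L + 1) = hi := hyhi
          rw [← this]; exact Nat.div_mul_le_self _ _
        exact_mod_cast this
      have e2 : (x : ℝ) ≤ (lo + 1) * (L + 1) := by
        have : x ≤ (lo + 1) * (L + 1) := by
          have : x / (L + 1) = lo := hxlo
          rw [← this]
          have := Nat.lt_div_mul_add (a := x) (b := L + 1) (by omega)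
          nlinarith
        exact_mod_cast this
      have : (hi : ℝ) - lo - 1 ≤ 4 * s / (L + 1) := by
        rw [le_div_iff₀ hLpos]; nlinarith
      linarith
    · rw [Finset.not_nonempty_iff_eq_empty] at hne
      rw [hne]; simp; positivity
  have hcs : (∑ i ∈ A.image c, ∑ k ∈ A with c k = i, b k) ^ 2 ≤
      (A.image c).card * ∑ i ∈ A.image c, (∑ k ∈ A with c k = i, b k) ^ 2 := sq_sum_le_card_mul_sum_sq
  set T := ∑ j ∈ Finset.range (n + 1), ∑ k ∈ Finset.range (n + 1),
      (if j ≤ k ∧ k ≤ j + L then b j * b k else 0) with hT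
  have hcell : ∑ i ∈ A.image c, (∑ k ∈ A with c k = i, b k) ^ 2 ≤ 2 * T := by
    have e : ∀ i ∈ A.image c, (∑ k ∈ A with c k = i, b k) ^ 2 =
        ∑ j ∈ A with c j = i, ∑ k ∈ A, if c j = c k then b j * b k else 0 := by
      intro i _
      rw [sq, Finset.sum_mul_sum]
      apply Finset.sum_congr rfl
      intro j hj
      rw [Finset.sum_filter]
      apply Finset.sum_congr rfl
      intro k _
      rw [(Finset.mem_filter.1 hj).2]
      simp only [eq_comm]
    rw [Finset.sum_congr rfl e,
      Finset.sum_fiberwise_of_maps_to (fun k hk => Finset.mem_image_of_mem c hk)]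
    have hAs : A ⊆ Finset.range (n + 1) := Finset.filter_subset _ _
    have hite : ∀ j k, 0 ≤ (if c j = c k then b j * b k else 0) := by
      intro j k; split_ifs
      · exact mul_nonneg (hnn j) (hnn k)
      · exact le_rfl
    calc _ ≤ ∑ j ∈ Finset.range (n + 1), ∑ k ∈ Finset.range (n + 1),
            (if c j = c k then b j * b k else 0) := by
          refine (Finset.sum_le_sum (fun j _ => Finset.sum_le_sum_of_subset_of_nonneg hAs
            (fun k _ _ => hite j k))).trans ?_
          exact Finset.sum_le_sum_of_subset_of_nonneg hAs
            (fun j _ _ => Finset.sum_nonneg (fun k _ => hite j k))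
      _ ≤ ∑ j ∈ Finset.range (n + 1), ∑ k ∈ Finset.range (n + 1),
            ((if j ≤ k ∧ k ≤ j + L then b j * b k else 0) +
             (if k ≤ j ∧ j ≤ k + L then b k * b j else 0)) := by
          apply Finset.sum_le_sum; intro j _
          apply Finset.sum_le_sum; intro k _
          have hjk := mul_nonneg (hnn j) (hnn k)
          have hkj := mul_nonneg (hnn k) (hnn j)
          by_cases hck : c j = c k
          · rw [if_pos hck]
            have hck' : j / (L + 1) = k / (L + 1) := hck
            have d1 := Nat.div_add_mod j (L + 1)
            have d2 := Nat.div_add_mod k (L + 1)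
            have m1 := Nat.mod_lt j (show 0 < L + 1 by omega)
            have m2 := Nat.mod_lt k (show 0 < L + 1 by omega)
            rw [hck'] at d1
            rcases le_total j k with h | h
            · rw [if_pos ⟨h, by omega⟩]
              split_ifs <;> linarith
            · rw [if_pos (show k ≤ j ∧ j ≤ k + L from ⟨h, by omega⟩)]
              split_ifs <;> linarith
          · rw [if_neg hck]
            split_ifs <;> linarith
      _ = 2 * T := by
          simp_rw [Finset.sum_add_distrib]
          rw [Finset.sum_comm (f := fun j k => if k ≤ j ∧ j ≤ k + L then b k * b j else 0)]
          rw [hT]; ring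
  have hpos : 0 < 4 * s / (L + 1) + 2 := by positivity
  rw [div_le_iff₀ hpos]
  rw [hmass] at hcs
  have hT0 : 0 ≤ 2 * T := le_trans (Finset.sum_nonneg (fun i _ => sq_nonneg _)) hcell
  have h9 : (9 : ℝ) / 16 ≤ (∑ k ∈ A, b k) ^ 2 := by nlinarith
  have : (9 : ℝ) / 16 ≤ (4 * s / (L + 1) + 2) * (2 * T) :=
    h9.trans (hcs.trans (by gcongr))
  linarith

lemma aux_pairs_lower (n : ℕ) (r lam : ℝ) (h0 : 0 < r) (h1 : r < 1) (hl0 : 0 ≤ lam) (hl1 : lam < 1)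
    (s : ℝ) (hs : 0 < s) (hs2 : n * r * (1 - r) ≤ s ^ 2) :
    (9 / 64) / (8 * (s * (1 - lam)) + 2) ≤
    ∑ j ∈ Finset.range (n + 1), ∑ k ∈ Finset.range (n + 1),
      (if j ≤ k then binomProb n r j * binomProb n r k * lam ^ (k - j) else 0) := by
  have hnn := aux_binom_nonneg n r h0.le h1.le
  have hl : 0 < 1 - lam := by linarith
  set L := ⌊1 / (2 * (1 - lam))⌋₊ with hL
  have hLle : (L : ℝ) ≤ 1 / (2 * (1 - lam)) := Nat.floor_le (by positivity)
  have hLlt : 1 / (2 * (1 - lam)) < L + 1 := Nat.lt_floor_add_one _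
  have hcells := aux_cells n r h0 h1 s hs hs2 L
  have hpow : ∀ d, d ≤ L → 1 / 2 ≤ lam ^ d := by
    intro d hd
    have h1 := one_add_mul_le_pow (a := lam - 1) (by linarith) d
    have hd' : (d : ℝ) ≤ 1 / (2 * (1 - lam)) := le_trans (by exact_mod_cast hd) hLle
    rw [le_div_iff₀ (by positivity)] at hd'
    have : (1 : ℝ) + (lam - 1) = lam := by ring
    rw [this] at h1
    nlinarith
  have hden : 4 * s / (L + 1) + 2 ≤ 8 * (s * (1 - lam)) + 2 := by
    have : 4 * s / (L + 1) ≤ 8 * (s * (1 - lam)) := by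
      rw [div_le_iff₀ (by positivity)]
      rw [div_lt_iff₀ (by positivity)] at hLlt
      nlinarith
    linarith
  have hpos : 0 < 4 * s / ((L : ℝ) + 1) + 2 := by positivity
  calc (9 / 64) / (8 * (s * (1 - lam)) + 2) ≤ (9 / 64) / (4 * s / (L + 1) + 2) := by gcongr
    _ = (1 / 2) * ((9 / 32) / (4 * s / (L + 1) + 2)) := by ring
    _ ≤ (1 / 2) * ∑ j ∈ Finset.range (n + 1), ∑ k ∈ Finset.range (n + 1),
      (if j ≤ k ∧ k ≤ j + L then binomProb n r j * binomProb n r k else 0) := by gcongr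
    _ ≤ _ := by
      rw [Finset.mul_sum]
      apply Finset.sum_le_sum; intro j _
      rw [Finset.mul_sum]
      apply Finset.sum_le_sum; intro k _
      have hjk := mul_nonneg (hnn j) (hnn k)
      by_cases h : j ≤ k
      · rw [if_pos h]
        by_cases h' : k ≤ j + L
        · rw [if_pos ⟨h, h'⟩]
          have := hpow (k - j) (by omega)
          nlinarith
        · rw [if_neg (by tauto)]
          have : 0 ≤ lam ^ (k - j) := by positivity
          rw [mul_zero]; exact mul_nonneg hjk this
      · rw [if_neg h, if_neg (by tauto)]; simp

lemma aux_tilt (n : ℕ) (x y u w : ℝ) (hx : 0 < x) (hy : 0 < y) (hu : 0 < u) (hw : 0 < w)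
    (hxu : x ^ 2 + u ^ 2 = 1) (hyw : y ^ 2 + w ^ 2 = 1) :
    prGE n (x ^ 2) n (y ^ 2) = (x * y + u * w) ^ (2 * n) *
    ∑ j ∈ Finset.range (n + 1), ∑ k ∈ Finset.range (n + 1),
      (if j ≤ k then binomProb n (x * y / (x * y + u * w)) j *
        binomProb n (x * y / (x * y + u * w)) k * (y * u / (x * w)) ^ (k - j) else 0) := by
  unfold prGE prGEshift
  rw [Finset.mul_sum]
  apply Finset.sum_congr rfl; intro j hj
  rw [Finset.mul_sum]
  apply Finset.sum_congr rfl; intro k hk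
  simp only [sub_zero, Nat.cast_le]
  by_cases h : j ≤ k
  · rw [if_pos h, if_pos h]
    obtain ⟨d, rfl⟩ := Nat.exists_eq_add_of_le h
    obtain ⟨e, rfl⟩ : ∃ e, n = j + d + e := by
      have : j + d ≤ n := by simpa [Nat.lt_succ_iff] using hk
      exact Nat.exists_eq_add_of_le this
    have hS : 0 < x * y + u * w := by positivity
    have h1 : 1 - x * y / (x * y + u * w) = u * w / (x * y + u * w) := by field_simp; ring
    unfold binomProb
    have e1 : 1 - x ^ 2 = u ^ 2 := by linarith
    have e2 : 1 - y ^ 2 = w ^ 2 := by linarith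
    rw [h1, e1, e2]
    have a1 : j + d + e - j = d + e := by omega
    have a2 : j + d + e - (j + d) = e := by omega
    have a3 : j + d - j = d := by omega
    rw [a1, a2, a3]
    set C1 := ((j + d + e).choose j : ℝ)
    set C2 := ((j + d + e).choose (j + d) : ℝ)
    set S := x * y + u * w with hSd
    have : S ^ (2 * (j + d + e)) = S ^ j * S ^ (d + e) * S ^ (j + d) * S ^ e := by
      rw [← pow_add, ← pow_add, ← pow_add]; congr 1; ring
    rw [this]
    simp only [div_pow, mul_pow]
    field_simp
    ring
  · rw [if_neg h, if_neg h, mul_zero]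

lemma aux_sqrt_bounds (m h : ℝ) (hm : 0 < m) (h0 : 0 ≤ h) (hhm : h ≤ m) :
    m - h ^ 2 / (2 * m) - h ^ 4 / (2 * m ^ 3) ≤ √(m ^ 2 - h ^ 2) ∧
    √(m ^ 2 - h ^ 2) ≤ m - h ^ 2 / (2 * m) := by
  obtain ⟨z, hz0, hz1, rfl⟩ : ∃ z : ℝ, 0 ≤ z ∧ z ≤ 1 ∧ h = m * z :=
    ⟨h / m, by positivity, by rw [div_le_one hm]; exact hhm, by field_simp⟩
  have e0 : m ^ 2 - (m * z) ^ 2 = m ^ 2 * (1 - z ^ 2) := by ring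
  have e1 : (m * z) ^ 2 / (2 * m) = m * (z ^ 2 / 2) := by field_simp
  have e2 : (m * z) ^ 4 / (2 * m ^ 3) = m * (z ^ 4 / 2) := by field_simp
  have hz2 : z ^ 2 ≤ 1 := by nlinarith
  rw [e0, e1, e2]
  constructor
  · apply Real.le_sqrt_of_sq_le
    have : (m - m * (z ^ 2 / 2) - m * (z ^ 4 / 2)) ^ 2
      = m ^ 2 * (1 - z ^ 2 / 2 - z ^ 4 / 2) ^ 2 := by ring
    rw [this]
    apply mul_le_mul_of_nonneg_left _ (by positivity)
    set q := z ^ 2 with hq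
    have : z ^ 4 = q ^ 2 := by rw [hq]; ring
    rw [this]
    have hq0 : 0 ≤ q := by positivity
    nlinarith [mul_nonneg (mul_nonneg hq0 hq0) (sub_nonneg.2 hz2),
      mul_nonneg (mul_nonneg (mul_nonneg hq0 hq0) hq0) (sub_nonneg.2 hz2), mul_nonneg hq0 hq0]
  · apply Real.sqrt_le_iff.2
    constructor
    · nlinarith
    · have : (m - m * (z ^ 2 / 2)) ^ 2 = m ^ 2 * (1 - z ^ 2 / 2) ^ 2 := by ring
      rw [this]
      apply mul_le_mul_of_nonneg_left _ (by positivity)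
      nlinarith [sq_nonneg (z ^ 2)]

lemma aux_S_upper (m h : ℝ) (hm : 0 < m) (h0 : 0 ≤ h) (hhm : h ≤ m) (hm1 : m ≤ 2 / 3)
    (hh1 : h ≤ 1 - m) :
    √(m ^ 2 - h ^ 2) + √((1 - m) ^ 2 - h ^ 2) ≤ exp (-(h ^ 2 / (2 * (m * (1 - m))))) := by
  have hm' : 0 < 1 - m := by linarith
  have h1 := (aux_sqrt_bounds m h hm h0 hhm).2
  have h2 := (aux_sqrt_bounds (1 - m) h hm' h0 hh1).2
  have h3 : h ^ 2 / (2 * m) + h ^ 2 / (2 * (1 - m)) = h ^ 2 / (2 * (m * (1 - m))) := by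
    field_simp; ring
  have := Real.add_one_le_exp (-(h ^ 2 / (2 * (m * (1 - m)))))
  linarith

lemma aux_S_lower (m h : ℝ) (hm : 0 < m) (h0 : 0 ≤ h) (hhm : h ≤ m) (hm1 : m ≤ 2 / 3)
    (hh1 : h ≤ 1 - m) (hs : h ^ 2 / m ≤ 1 / 12) :
    1 / 2 ≤ √(m ^ 2 - h ^ 2) + √((1 - m) ^ 2 - h ^ 2) ∧
    exp (-(h ^ 2 / (2 * (m * (1 - m))) + 77 * (h ^ 4 / m ^ 3))) ≤
      √(m ^ 2 - h ^ 2) + √((1 - m) ^ 2 - h ^ 2) := by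
  have hm' : 0 < 1 - m := by linarith
  have h1 := (aux_sqrt_bounds m h hm h0 hhm).1
  have h2 := (aux_sqrt_bounds (1 - m) h hm' h0 hh1).1
  have h3 : h ^ 2 / (2 * m) + h ^ 2 / (2 * (1 - m)) = h ^ 2 / (2 * (m * (1 - m))) := by
    field_simp; ring
  have h4 : h ^ 4 / (2 * (1 - m) ^ 3) ≤ 4 * (h ^ 4 / m ^ 3) := by
    have : 4 * (h ^ 4 / m ^ 3) = h ^ 4 / (2 * (m / 2) ^ 3) := by field_simp; ring
    rw [this]
    have : m / 2 ≤ 1 - m := by linarith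
    gcongr
  have h5 : h ^ 4 / (2 * m ^ 3) = (1 / 2) * (h ^ 4 / m ^ 3) := by field_simp
  set S := √(m ^ 2 - h ^ 2) + √((1 - m) ^ 2 - h ^ 2) with hS
  set g := h ^ 4 / m ^ 3 with hg
  have hg0 : 0 ≤ g := by positivity
  set f := h ^ 2 / m with hf
  have hf0 : 0 ≤ f := by positivity
  have hgf : g ≤ f := by
    rw [hg, hf, div_le_div_iff₀ (by positivity) hm]
    have : h ^ 2 ≤ m ^ 2 := by gcongr
    have h6 : 0 ≤ h ^ 2 * m := by positivity
    nlinarith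
  have hff : f ^ 2 ≤ g := by
    rw [hg, hf, div_pow, div_le_div_iff₀ (by positivity) (by positivity)]
    have : m ^ 3 ≤ m ^ 2 := by nlinarith [sq_nonneg m]
    have h6 : 0 ≤ h ^ 4 := by positivity
    nlinarith
  have h7 : h ^ 2 / (2 * (m * (1 - m))) ≤ (3 / 2) * f := by
    rw [hf, ← mul_div_assoc, div_le_div_iff₀ (by positivity) hm]
    have h6 : 0 ≤ h ^ 2 * m := by positivity
    nlinarith
  have h70 : 0 ≤ h ^ 2 / (2 * (m * (1 - m))) := by positivity
  have hH : 1 - S ≤ h ^ 2 / (2 * (m * (1 - m))) + (9 / 2) * g := by linarith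
  have hH6 : 1 - S ≤ 6 * f := by linarith
  have hShalf : 1 / 2 ≤ S := by linarith
  refine ⟨hShalf, ?_⟩
  have hSpos : 0 < S := by linarith
  rw [← Real.le_log_iff_exp_le hSpos]
  have hlog := Real.one_sub_inv_le_log_of_pos hSpos
  refine le_trans ?_ hlog
  -- S⁻¹ - 1 ≤ H + 2 H^2
  have hS1 : S ≤ 1 := by
    have := aux_S_upper m h hm h0 hhm hm1 hh1
    refine this.trans (Real.exp_le_one_iff.2 (by linarith))
  have hinv : S⁻¹ ≤ 1 + (1 - S) + 2 * (1 - S) ^ 2 := by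
    rw [inv_le_iff_one_le_mul₀ hSpos]
    have : 0 ≤ (1 - S) ^ 2 * (2 * S - 1) := mul_nonneg (sq_nonneg _) (by linarith)
    nlinarith
  have hsq : (1 - S) ^ 2 ≤ 36 * g := by
    have : (1 - S) ^ 2 ≤ (6 * f) ^ 2 := by
      apply pow_le_pow_left₀ (by linarith) hH6
    nlinarith
  linarith

lemma aux_pack (n : ℕ) (a b : ℝ) (hb : 0 < b) (hab : b < a) (ha : a ≤ 2 / 3) :
    ∃ r lam S : ℝ, S = √(((a + b) / 2) ^ 2 - ((a - b) / 2) ^ 2) +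
        √((1 - (a + b) / 2) ^ 2 - ((a - b) / 2) ^ 2) ∧ 0 < S ∧ S ≤ 1 ∧
      b ≤ r ∧ 1 / 3 ≤ 1 - r ∧ (1 / 2 ≤ S → r ≤ a + b) ∧ 0 ≤ lam ∧ lam < 1 ∧
      (a - b) / (2 * a) ≤ 1 - lam ∧ 1 - lam ≤ (a - b) * 3 / a ∧
      prGE n a n b = S ^ (2 * n) * ∑ j ∈ Finset.range (n + 1), ∑ k ∈ Finset.range (n + 1),
      (if j ≤ k then binomProb n r j * binomProb n r k * lam ^ (k - j) else 0) := by
  have ha0 : 0 < a := by linarith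
  obtain ⟨x, hx, hxa⟩ : ∃ x : ℝ, 0 < x ∧ x ^ 2 = a := ⟨√a, by positivity, Real.sq_sqrt ha0.le⟩
  obtain ⟨y, hy, hyb⟩ : ∃ x : ℝ, 0 < x ∧ x ^ 2 = b := ⟨√b, by positivity, Real.sq_sqrt hb.le⟩
  have ha1 : 0 < 1 - a := by linarith
  have hb1 : 0 < 1 - b := by linarith
  obtain ⟨u, hu, hua⟩ : ∃ x : ℝ, 0 < x ∧ x ^ 2 = 1 - a := ⟨√(1 - a), by positivity, Real.sq_sqrt ha1.le⟩
  obtain ⟨w, hw, hwb⟩ : ∃ x : ℝ, 0 < x ∧ x ^ 2 = 1 - b := ⟨√(1 - b), by positivity, Real.sq_sqrt hb1.le⟩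
  have hyx : y < x := by
    apply lt_of_pow_lt_pow_left₀ 2 hx.le; linarith
  have huw : u < w := by
    apply lt_of_pow_lt_pow_left₀ 2 hw.le; linarith
  have hS1 : x * y + u * w ≤ 1 := by nlinarith [sq_nonneg (x - y), sq_nonneg (u - w)]
  have hS0 : 0 < x * y + u * w := by positivity
  have e1 : √(((a + b) / 2) ^ 2 - ((a - b) / 2) ^ 2) = x * y := by
    rw [show ((a + b) / 2) ^ 2 - ((a - b) / 2) ^ 2 = (x * y) ^ 2 by rw [mul_pow, hxa, hyb]; ring]
    exact Real.sqrt_sq (by positivity)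
  have e2 : √((1 - (a + b) / 2) ^ 2 - ((a - b) / 2) ^ 2) = u * w := by
    rw [show (1 - (a + b) / 2) ^ 2 - ((a - b) / 2) ^ 2 = (u * w) ^ 2 by rw [mul_pow, hua, hwb]; ring]
    exact Real.sqrt_sq (by positivity)
  have hlam2 : (y * u / (x * w)) ^ 2 = b * (1 - a) / (a * (1 - b)) := by
    rw [div_pow, mul_pow, mul_pow, hxa, hyb, hua, hwb]
  have hlam0 : 0 < y * u / (x * w) := by positivity
  have hlam1 : y * u / (x * w) < 1 := by
    rw [div_lt_one (by positivity)]
    exact mul_lt_mul'' hyx huw hy.le hu.le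
  have hl2 : 1 - (y * u / (x * w)) ^ 2 = (a - b) / (a * (1 - b)) := by
    rw [hlam2]; field_simp; ring
  refine ⟨x * y / (x * y + u * w), y * u / (x * w), x * y + u * w, by rw [e1, e2], hS0, hS1,
    ?_, ?_, ?_, hlam0.le, hlam1, ?_, ?_, ?_⟩
  · rw [le_div_iff₀ hS0]
    calc b * (x * y + u * w) ≤ b * 1 := by gcongr
      _ = y * y := by rw [← hyb]; ring
      _ ≤ x * y := by gcongr
  · have : 1 - x * y / (x * y + u * w) = u * w / (x * y + u * w) := by field_simp; ring
    rw [this, le_div_iff₀ hS0]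
    calc 1 / 3 * (x * y + u * w) ≤ 1 / 3 * 1 := by gcongr
      _ ≤ u * u := by nlinarith
      _ ≤ u * w := by gcongr
  · intro hS
    rw [div_le_iff₀ hS0]
    have : x * y ≤ (a + b) / 2 := by nlinarith [sq_nonneg (x - y)]
    nlinarith
  · set lam := y * u / (x * w)
    have h1 : 1 - lam ^ 2 ≤ 2 * (1 - lam) := by nlinarith [sq_nonneg (1 - lam)]
    rw [hl2] at h1
    have : (a - b) / a ≤ (a - b) / (a * (1 - b)) := by
      have : 0 < a - b := by linarith
      gcongr
      nlinarith
    have h3 : (a - b) / (2 * a) = ((a - b) / a) / 2 := by field_simp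
    rw [h3]; linarith
  · set lam := y * u / (x * w)
    have h1 : 1 - lam ≤ 1 - lam ^ 2 := by nlinarith
    rw [hl2] at h1
    refine h1.trans ?_
    rw [div_le_div_iff₀ (by positivity) ha0]
    have : 0 < (a - b) * a := mul_pos (by linarith) ha0
    nlinarith
  · have := aux_tilt n x y u w hx hy hu hw (by linarith) (by linarith)
    rw [hxa, hyb] at this
    exact this

lemma aux_sigma (a b : ℝ) :
    a * (1 - a) + b * (1 - b) =
      2 * ((a + b) / 2 * (1 - (a + b) / 2) - ((a - b) / 2) ^ 2) := by ring

/-- crude Chernoff bound -/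
lemma aux_crude (n : ℕ) (a b : ℝ) (hb : 0 < b) (hab : b < a) (ha : a ≤ 2 / 3) :
    prGE n a n b ≤ exp (-((n * (a - b) ^ 2 / (2 * (a * (1 - a) + b * (1 - b)))) / 3)) := by
  obtain ⟨r, lam, S, hS, hS0, hS1, hr, hr1, -, hl0, hl1, -, -, hP⟩ := aux_pack n a b hb hab ha
  rw [hP]
  have hr0 : 0 ≤ r := by linarith
  have hr1' : r ≤ 1 := by linarith
  have hnn := aux_binom_nonneg n r hr0 hr1'
  have hsum : ∑ j ∈ Finset.range (n + 1), ∑ k ∈ Finset.range (n + 1),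
      (if j ≤ k then binomProb n r j * binomProb n r k * lam ^ (k - j) else 0) ≤ 1 := by
    calc _ ≤ ∑ j ∈ Finset.range (n + 1), ∑ k ∈ Finset.range (n + 1),
        binomProb n r j * binomProb n r k := by
          apply Finset.sum_le_sum; intro j _
          apply Finset.sum_le_sum; intro k _
          have hjk := mul_nonneg (hnn j) (hnn k)
          split_ifs
          · have := pow_le_one₀ hl0 hl1.le (n := k - j)
            nlinarith
          · exact hjk
      _ = 1 := by rw [← Finset.sum_mul_sum, aux_binom_sum, one_mul]
  have hSu := aux_S_upper ((a + b) / 2) ((a - b) / 2) (by linarith) (by linarith) (by linarith)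
    (by linarith) (by linarith)
  rw [← hS] at hSu
  calc _ ≤ S ^ (2 * n) * 1 := by gcongr
    _ = S ^ (2 * n) := mul_one _
    _ ≤ (exp (-(((a - b) / 2) ^ 2 / (2 * ((a + b) / 2 * (1 - (a + b) / 2)))))) ^ (2 * n) := by gcongr
    _ = exp (-(n * (((a - b) / 2) ^ 2 / ((a + b) / 2 * (1 - (a + b) / 2))))) := by
        rw [← Real.exp_nat_mul]; congr 1; push_cast; field_simp
    _ ≤ _ := by
        apply Real.exp_le_exp.2
        rw [neg_le_neg_iff, mul_div_assoc, mul_div_assoc]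
        apply mul_le_mul_of_nonneg_left _ (by positivity)
        have hV : 0 < (a + b) / 2 * (1 - (a + b) / 2) := mul_pos (by linarith) (by linarith)
        have hs : 0 < a * (1 - a) + b * (1 - b) :=
          add_pos (mul_pos (by linarith) (by linarith)) (mul_pos (by linarith) (by linarith))
        rw [div_div, div_le_div_iff₀ (by positivity) hV]
        have : (a + b) / 2 * (1 - (a + b) / 2) * 4 ≤ 2 * (a * (1 - a) + b * (1 - b)) * 3 := by nlinarith
        nlinarith [mul_le_mul_of_nonneg_left this (sq_nonneg (a - b))]

set_option maxHeartbeats 1000000 in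
/-- fine upper bound -/
lemma aux_fine_upper (n : ℕ) (a b : ℝ) (hb : 0 < b) (hab : b < a) (ha : a ≤ 2 / 3) (hn : 1 ≤ n)
    (hG : n * ((a - b) / 2) ^ 4 ≤ ((a + b) / 2) ^ 3) (hh : (a - b) / 2 ≤ (a + b) / 2 / 2)
    (hnm : 6 ≤ n * ((a + b) / 2)) :
    n * prGE n a n b ≤ (exp 9 * 96) * (√n * √(a * (1 - a) + b * (1 - b)) / (a - b) *
      exp (-(n * (a - b) ^ 2 / (2 * (a * (1 - a) + b * (1 - b)))))) := by
  obtain ⟨r, lam, S, hS, hS0, hS1, hr, hr1, -, hl0, hl1, hl2, -, hP⟩ := aux_pack n a b hb hab ha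
  rw [hP]
  have hr0 : 0 < r := by linarith
  have hr1' : r < 1 := by linarith
  have hn0 : (0 : ℝ) < n := by exact_mod_cast hn
  set m := (a + b) / 2 with hm
  set h := (a - b) / 2 with hh'
  have hm0 : 0 < m := by linarith
  have hm1 : m ≤ 2 / 3 := by linarith
  have hh0 : 0 < h := by linarith
  have hbm : m / 2 ≤ b := by linarith
  have hv : n * m / 6 ≤ ((n : ℝ) + 1) * r * (1 - r) := by
    have : m / 2 ≤ r := by linarith
    calc n * m / 6 = n * (m / 2) * (1 / 3) := by ring
      _ ≤ _ := by gcongr; linarith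
  have hmax := aux_binom_max n r hr0 hr1' (by linarith)
  have hsum := aux_pairs_upper n r lam _ hr0.le hr1'.le hl0 hl1 (by positivity) hmax
  have hsum2 : ∑ j ∈ Finset.range (n + 1), ∑ k ∈ Finset.range (n + 1),
      (if j ≤ k then binomProb n r j * binomProb n r k * lam ^ (k - j) else 0) ≤
      (4 / √(n * m / 6)) / (h / (2 * m)) := by
    refine hsum.trans ?_
    have h1 : h / (2 * m) ≤ 1 - lam := by
      refine le_trans ?_ hl2
      rw [div_le_div_iff₀ (by positivity) (by linarith)]
      have : a ≤ 2 * m := by linarith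
      have : a - b = 2 * h := by rw [hh']; ring
      rw [this]; nlinarith
    gcongr
  have hSu := aux_S_upper m h (by linarith) (by linarith) (by linarith)
    (by linarith) (by linarith)
  rw [← hS] at hSu
  have hsig := aux_sigma a b
  rw [← hm, ← hh'] at hsig
  set σ2 := a * (1 - a) + b * (1 - b) with hσ
  have hσl : 2 * m / 3 ≤ σ2 := by rw [hσ, hm]; nlinarith
  have hσ0 : 0 < σ2 := by linarith
  have hV : 0 < m * (1 - m) := mul_pos hm0 (by linarith)
  have hexp : S ^ (2 * n) ≤ exp 9 * exp (-(n * (a - b) ^ 2 / (2 * σ2))) := by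
    calc S ^ (2 * n) ≤ (exp (-(h ^ 2 / (2 * (m * (1 - m)))))) ^ (2 * n) := by gcongr
      _ = exp (-(n * (h ^ 2 / (m * (1 - m))))) := by
        rw [← Real.exp_nat_mul]; congr 1; push_cast; field_simp
      _ ≤ _ := by
        rw [← Real.exp_add]
        apply Real.exp_le_exp.2
        have e : n * (a - b) ^ 2 / (2 * σ2) = n * (h ^ 2 / (m * (1 - m))) +
            (n * h ^ 4) * (1 / ((m * (1 - m)) * (σ2 / 2))) := by
          have : m * (1 - m) = σ2 / 2 + h ^ 2 := by linarith
          have h2 : a - b = 2 * h := by rw [hh']; ring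
          rw [this, h2]
          have : 0 < σ2 / 2 + h ^ 2 := by positivity
          field_simp
        have h2 : (n * h ^ 4) * (1 / ((m * (1 - m)) * (σ2 / 2))) ≤ 9 := by
          rw [mul_one_div, div_le_iff₀ (by positivity)]
          refine hG.trans ?_
          have h3 : m / 3 ≤ m * (1 - m) := by nlinarith
          have h4 : m / 3 * (m / 3) ≤ m * (1 - m) * (σ2 / 2) :=
            mul_le_mul h3 (by linarith) (by positivity) hV.le
          have h5 : m ^ 3 ≤ m ^ 2 := by nlinarith [sq_nonneg m]
          linarith [show m / 3 * (m / 3) = m ^ 2 / 9 by ring]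
        rw [e]; linarith
  have hsq : √m ≤ 2 * √σ2 := by
    rw [show (2 : ℝ) * √σ2 = √(4 * σ2) by
      rw [Real.sqrt_mul (by norm_num), show (4 : ℝ) = 2 ^ 2 by norm_num, Real.sqrt_sq (by norm_num)]]
    apply Real.sqrt_le_sqrt; linarith
  have hs6 : √6 ≤ (3 : ℝ) := by rw [Real.sqrt_le_iff]; norm_num
  set E := exp (-(n * (a - b) ^ 2 / (2 * σ2)))
  have hE : 0 < E := Real.exp_pos _
  have h9 : 0 < exp (9 : ℝ) := Real.exp_pos _
  have hab2 : a - b = 2 * h := by rw [hh']; ring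
  generalize (∑ j ∈ Finset.range (n + 1), ∑ k ∈ Finset.range (n + 1),
      (if j ≤ k then binomProb n r j * binomProb n r k * lam ^ (k - j) else 0)) = T at *
  calc _ ≤ n * ((exp 9 * E) * ((4 / √(n * m / 6)) / (h / (2 * m)))) := by
          refine mul_le_mul_of_nonneg_left ?_ hn0.le
          exact (mul_le_mul_of_nonneg_left hsum2 (by positivity)).trans
            (mul_le_mul_of_nonneg_right hexp (by positivity))
    _ = exp 9 * E * (8 * √6 * (√n * √m / h)) := by
      rw [Real.sqrt_div (by positivity), Real.sqrt_mul hn0.le]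
      have e1 : (n : ℝ) = √n * √n := (Real.mul_self_sqrt hn0.le).symm
      have e2 : m = √m * √m := (Real.mul_self_sqrt hm0.le).symm
      have p1 : 0 < √(n : ℝ) := by positivity
      have p2 : 0 < √m := by positivity
      have p3 : 0 < √(6 : ℝ) := by positivity
      generalize √(n : ℝ) = X at *
      generalize √m = Y at *
      rw [e1, e2]
      field_simp
      ring
    _ ≤ exp 9 * E * (8 * 3 * (√n * (2 * √σ2) / h)) := by gcongr
    _ = _ := by rw [hab2]; field_simp; ring

set_option maxHeartbeats 1000000 in
lemma aux_fine_lower (n : ℕ) (a b : ℝ) (hb : 0 < b) (hab : b < a) (ha : a ≤ 2 / 3) (hn : 144 ≤ n)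
    (hG : n * ((a - b) / 2) ^ 4 ≤ ((a + b) / 2) ^ 3) :
    (exp (-154) * (9 / 64 / 48)) * (exp (-(n * (a - b) ^ 2 / (2 * (a * (1 - a) + b * (1 - b)))))
       / (√n * (a - b) / √(a * (1 - a) + b * (1 - b)) + 1)) ≤ prGE n a n b := by
  obtain ⟨r, lam, S, hS, hS0, hS1, hr, hr1, hr2, hl0, hl1, -, hl2, hP⟩ := aux_pack n a b hb hab ha
  rw [hP]
  have hr0 : 0 < r := by linarith
  have hr1' : r < 1 := by linarith
  have hn' : (144 : ℝ) ≤ n := by exact_mod_cast hn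
  have hn0 : (0 : ℝ) < n := by linarith
  set m := (a + b) / 2 with hm
  set h := (a - b) / 2 with hh'
  have hm0 : 0 < m := by linarith
  have hm1 : m ≤ 2 / 3 := by linarith
  have hh0 : 0 < h := by linarith
  have hab2 : a - b = 2 * h := by rw [hh']; ring
  have hg : h ^ 2 / m ≤ 1 / 12 := by
    have h1 : (h ^ 2 / m) ^ 2 ≤ (1 / 12) ^ 2 := by
      rw [div_pow, div_le_iff₀ (by positivity)]
      have h2 : n * h ^ 4 ≤ m ^ 2 := hG.trans (by nlinarith [sq_nonneg m])
      have h4 : 0 ≤ h ^ 4 := by positivity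
      nlinarith
    exact le_of_sq_le_sq h1 (by norm_num)
  obtain ⟨hSh, hSl⟩ := aux_S_lower m h hm0 hh0.le (by linarith) hm1 (by linarith) hg
  rw [← hS] at hSl hSh
  have hrm : r ≤ 2 * m := by have := hr2 hSh; linarith
  have hsig := aux_sigma a b
  rw [← hm, ← hh'] at hsig
  set σ2 := a * (1 - a) + b * (1 - b) with hσ
  have hσl : 2 * m / 3 ≤ σ2 := by rw [hσ, hm]; nlinarith
  have hσu : σ2 ≤ 2 * m := by nlinarith [sq_nonneg m, sq_nonneg h]
  have hσ0 : 0 < σ2 := by linarith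
  have hV : 0 < m * (1 - m) := mul_pos hm0 (by linarith)
  have hexp : exp (-154) * exp (-(n * (a - b) ^ 2 / (2 * σ2))) ≤ S ^ (2 * n) := by
    calc _ ≤ exp (-(n * (h ^ 2 / (m * (1 - m)) + 154 * (h ^ 4 / m ^ 3)))) := by
          rw [← Real.exp_add]
          apply Real.exp_le_exp.2
          have h1 : n * (h ^ 2 / (m * (1 - m))) ≤ n * (a - b) ^ 2 / (2 * σ2) := by
            have : n * (a - b) ^ 2 / (2 * σ2) = n * (h ^ 2 / (σ2 / 2)) := by
              rw [hab2]; field_simp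
            rw [this]
            have : σ2 / 2 ≤ m * (1 - m) := by nlinarith [sq_nonneg h]
            gcongr
          have h2 : n * (h ^ 4 / m ^ 3) ≤ 1 := by
            rw [← mul_div_assoc, div_le_one (by positivity)]; exact hG
          linarith
      _ = (exp (-(h ^ 2 / (2 * (m * (1 - m))) + 77 * (h ^ 4 / m ^ 3)))) ^ (2 * n) := by
          rw [← Real.exp_nat_mul]; congr 1; push_cast; field_simp; ring
      _ ≤ _ := by gcongr
  set s := √(2 * n * m) with hs
  have hs0 : 0 < s := by positivity
  have hs2 : n * r * (1 - r) ≤ s ^ 2 := by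
    rw [hs, Real.sq_sqrt (by positivity)]
    calc n * r * (1 - r) ≤ n * (2 * m) * 1 := by gcongr; linarith
      _ = _ := by ring
  have hlow := aux_pairs_lower n r lam hr0 hr1' hl0 hl1 s hs0 hs2
  set t := √n * (a - b) / √σ2 with ht
  have ht0 : 0 ≤ t := by
    have : 0 < a - b := by linarith
    positivity
  have hst : s * (1 - lam) ≤ 6 * t := by
    have h1 : 1 - lam ≤ 6 * h / m := by
      refine hl2.trans ?_
      rw [div_le_div_iff₀ (by linarith) hm0, hab2]
      have : m ≤ a := by linarith
      nlinarith
    have h2 : (s * (6 * h / m)) ^ 2 ≤ (6 * t) ^ 2 := by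
      have q1 : s ^ 2 = 2 * n * m := Real.sq_sqrt (by positivity)
      have q2 : t ^ 2 = n * (2 * h) ^ 2 / σ2 := by
        rw [ht, hab2, div_pow, mul_pow, Real.sq_sqrt hn0.le, Real.sq_sqrt hσ0.le]
      have e1 : (s * (6 * h / m)) ^ 2 = (72 * n * h ^ 2) * (1 / m) := by
        rw [mul_pow s, q1]; clear_value m h; field_simp; ring
      have e2 : (6 * t) ^ 2 = (72 * n * h ^ 2) * (2 / σ2) := by
        rw [mul_pow 6 t, q2]; clear_value h σ2; field_simp; ring
      rw [e1, e2]
      apply mul_le_mul_of_nonneg_left _ (by positivity)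
      rw [div_le_div_iff₀ hm0 hσ0]; linarith
    calc _ ≤ s * (6 * h / m) := by gcongr
      _ ≤ 6 * t := le_of_sq_le_sq h2 (by positivity)
  set E := exp (-(n * (a - b) ^ 2 / (2 * σ2)))
  have hE : 0 < E := Real.exp_pos _
  have hlam : 0 ≤ s * (1 - lam) := mul_nonneg hs0.le (by linarith)
  generalize (∑ j ∈ Finset.range (n + 1), ∑ k ∈ Finset.range (n + 1),
      (if j ≤ k then binomProb n r j * binomProb n r k * lam ^ (k - j) else 0)) = T at *
  calc _ = (exp (-154) * E) * ((9 / 64) / (48 * t + 48)) := by field_simp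
    _ ≤ (exp (-154) * E) * ((9 / 64) / (8 * (s * (1 - lam)) + 2)) := by
      refine mul_le_mul_of_nonneg_left ?_ (by positivity)
      exact div_le_div_of_nonneg_left (by norm_num) (by linarith) (by linarith)
    _ ≤ _ := mul_le_mul hexp hlow (div_nonneg (by norm_num) (by linarith)) (by positivity)

/-- The final argument for ordered sequences `b n < a n`. -/
lemma aux_main (a b : ℕ → ℝ) (hb0 : ∀ n, 0 ≤ b n) (hab : ∀ n, b n < a n) (ha : ∀ n, a n ≤ 2 / 3)
    (hb' : Tendsto (fun n : ℕ => (n : ℝ) * b n / (Real.log n) ^ 3) atTop atTop) :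
    Tendsto (fun n : ℕ => (n : ℝ) * prGE n (a n) n (b n)) atTop (nhds 0) ↔
    Tendsto (fun n : ℕ =>
      √n * √(a n * (1 - a n) + b n * (1 - b n)) / (a n - b n) *
        exp (-((n : ℝ) * (a n - b n) ^ 2 / (2 * (a n * (1 - a n) + b n * (1 - b n))))))
      atTop (nhds 0) := by
  set τ : ℕ → ℝ := fun n => (n : ℝ) * (a n - b n) ^ 2 / (2 * (a n * (1 - a n) + b n * (1 - b n)))
    with hτ
  set E : ℕ → ℝ := fun n => √n * √(a n * (1 - a n) + b n * (1 - b n)) / (a n - b n) * exp (-(τ n))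
    with hE
  set P : ℕ → ℝ := fun n => prGE n (a n) n (b n) with hP
  have hlog : Tendsto (fun n : ℕ => Real.log n) atTop atTop :=
    Real.tendsto_log_atTop.comp tendsto_natCast_atTop_atTop
  have hE0 : ∀ n, 0 ≤ E n := by
    intro n
    have := hab n
    have : 0 < a n - b n := by linarith
    simp only [hE]; positivity
  -- the regular regime
  have hreg : ∀ᶠ n : ℕ in atTop, 144 ≤ n ∧ 1 ≤ Real.log n ∧ 0 < b n ∧
      144 * Real.log n ^ 3 ≤ n * b n := by
    filter_upwards [eventually_ge_atTop 144, hlog.eventually_ge_atTop 1,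
      hb'.eventually_ge_atTop 144] with n h1 h2 h3
    have hl3 : 0 < Real.log n ^ 3 := by positivity
    rw [le_div_iff₀ hl3] at h3
    refine ⟨h1, h2, ?_, h3⟩
    have hn : (0 : ℝ) < n := by exact_mod_cast (by omega : 0 < n)
    by_contra hcon
    push Not at hcon
    nlinarith
  have hP0 : ∀ᶠ n : ℕ in atTop, 0 ≤ P n := by
    filter_upwards [hreg] with n hn
    simp only [hP, prGE, prGEshift]
    apply Finset.sum_nonneg; intro j _
    apply Finset.sum_nonneg; intro k _
    have := hab n
    have := ha n
    split_ifs
    · exact mul_nonneg (aux_binom_nonneg _ _ (by linarith [hn.2.2.1]) (by linarith) _)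
        (aux_binom_nonneg _ _ hn.2.2.1.le (by linarith) _)
    · exact le_rfl
  set c : ℝ := exp (-154) * (9 / 64 / 48) with hc
  have hc0 : 0 < c := by positivity
  have hfine : ∀ᶠ n : ℕ in atTop, τ n ≤ 6 * Real.log n →
      n * P n ≤ (exp 9 * 96) * E n ∧
      c * (exp (-(τ n)) / (√n * (a n - b n) / √(a n * (1 - a n) + b n * (1 - b n)) + 1)) ≤ P n := by
    filter_upwards [hreg] with n hn ht
    obtain ⟨hn1, hl1, hbpos, hnb⟩ := hn
    have hab := hab n
    have ha := ha n
    simp only [hE, hP]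
    simp only [hτ] at ht ⊢
    generalize a n = a at *
    generalize b n = b at *
    have hn' : (144 : ℝ) ≤ n := by exact_mod_cast hn1
    have hn0 : (0 : ℝ) < n := by linarith
    generalize Real.log n = l at *
    have hσu : a * (1 - a) + b * (1 - b) ≤ a + b := by nlinarith
    have hσ0 : 0 < a * (1 - a) + b * (1 - b) :=
      add_pos (mul_pos (by linarith) (by linarith)) (mul_pos (by linarith) (by linarith))
    have hl0 : 0 ≤ l := by linarith
    rw [div_le_iff₀ (by positivity)] at ht
    -- n h^2 ≤ 6 m l
    have h1 : n * ((a - b) / 2) ^ 2 ≤ 6 * l * ((a + b) / 2) := by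
      have : 6 * l * (2 * (a * (1 - a) + b * (1 - b))) ≤ 6 * l * (2 * (a + b)) := by gcongr
      nlinarith
    have hm0 : 0 < (a + b) / 2 := by linarith
    have hnm : 144 * l ^ 3 ≤ n * ((a + b) / 2) := by
      refine hnb.trans ?_
      gcongr; linarith
    have hh0 : 0 < (a - b) / 2 := by linarith
    have hl3 : l ≤ l ^ 3 := le_self_pow₀ hl1 (by norm_num)
    have hl23 : l ^ 2 ≤ l ^ 3 := pow_le_pow_right₀ hl1 (by norm_num)
    have hhm : (a - b) / 2 ≤ (a + b) / 2 / 2 := by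
      apply le_of_sq_le_sq _ (by positivity)
      have h2 : n * ((a - b) / 2) ^ 2 ≤ n * ((a + b) / 2 / 2) ^ 2 := by
        refine h1.trans ?_
        have : 24 * l * ((a + b) / 2) ≤ n * ((a + b) / 2) * ((a + b) / 2) :=
          mul_le_mul_of_nonneg_right (by linarith) hm0.le
        nlinarith
      exact le_of_mul_le_mul_left h2 hn0
    have hG : n * ((a - b) / 2) ^ 4 ≤ ((a + b) / 2) ^ 3 := by
      generalize (a - b) / 2 = h at *
      generalize (a + b) / 2 = m at *
      have h2 : (n * h ^ 2) ^ 2 ≤ (6 * l * m) ^ 2 := by gcongr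
      have h3 : (6 * l * m) ^ 2 ≤ n * m ^ 3 := by
        have : 36 * l ^ 2 * m ^ 2 ≤ n * m * m ^ 2 :=
          mul_le_mul_of_nonneg_right (by linarith [sq_nonneg l]) (by positivity)
        nlinarith
      have h4 : n * (n * h ^ 4) ≤ n * m ^ 3 := by nlinarith
      exact le_of_mul_le_mul_left h4 hn0
    refine ⟨aux_fine_upper n a b hbpos hab ha (by omega) hG hhm (by linarith), ?_⟩
    exact aux_fine_lower n a b hbpos hab ha hn1 hG
  have hone : Tendsto (fun n : ℕ => (1 : ℝ) / n) atTop (nhds 0) := tendsto_one_div_atTop_nhds_zero_nat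
  -- E in terms of t
  have hEt : ∀ᶠ n : ℕ in atTop, 0 < √n * (a n - b n) / √(a n * (1 - a n) + b n * (1 - b n)) ∧
      (√n * (a n - b n) / √(a n * (1 - a n) + b n * (1 - b n))) ^ 2 = 2 * τ n ∧
      E n = n * (exp (-(τ n)) / (√n * (a n - b n) / √(a n * (1 - a n) + b n * (1 - b n)))) := by
    filter_upwards [hreg] with n hn
    have hab := hab n
    have ha := ha n
    have hn0 : (0 : ℝ) < n := by exact_mod_cast (by omega : 0 < n)
    have hσ0 : 0 < a n * (1 - a n) + b n * (1 - b n) :=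
      add_pos (mul_pos (by linarith [hn.2.2.1]) (by linarith))
        (mul_pos (by linarith [hn.2.2.1]) (by linarith))
    have hδ : 0 < a n - b n := by linarith
    refine ⟨by positivity, ?_, ?_⟩
    · rw [div_pow, mul_pow, Real.sq_sqrt hn0.le, Real.sq_sqrt hσ0.le]
      simp only [hτ]
      field_simp
    · simp only [hE]
      have e1 : (n : ℝ) = √n * √n := (Real.mul_self_sqrt hn0.le).symm
      have p1 : 0 < √(n : ℝ) := by positivity
      generalize exp (-(τ n)) = X
      rw [eq_comm]
      nth_rewrite 1 [e1]
      field_simp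
  constructor
  · intro hnP
    have hsmall : ∀ᶠ n : ℕ in atTop, n * P n < c * exp (-(1 / 2)) / 2 := by
      exact hnP.eventually_lt_const (by positivity)
    have hbound : ∀ᶠ n : ℕ in atTop, E n ≤ (2 / c) * (n * P n) + 1 / n := by
      filter_upwards [hreg, hfine, hEt, hsmall, hP0] with n hn hf het hs hp0
      obtain ⟨ht0, ht2, hEq⟩ := het
      set t := √n * (a n - b n) / √(a n * (1 - a n) + b n * (1 - b n)) with htdef
      have hn1 : (144 : ℝ) ≤ n := by exact_mod_cast hn.1
      have hn0 : (0 : ℝ) < n := by linarith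
      have hinv : 0 < 1 / (n : ℝ) := by positivity
      have hPn : 0 ≤ (2 / c) * (n * P n) := by positivity
      by_cases hτn : τ n ≤ 6 * Real.log n
      · have hlow := (hf hτn).2
        by_cases ht1 : t ≤ 1
        · exfalso
          have hτh : τ n ≤ 1 / 2 := by nlinarith
          have h1 : c * (exp (-(1 / 2)) / 2) ≤ P n := by
            refine le_trans ?_ hlow
            gcongr
            linarith
          nlinarith
        · push Not at ht1
          have h1 : c * (exp (-(τ n)) / (2 * t)) ≤ P n := by
            refine le_trans ?_ hlow
            gcongr
            linarith
          have h2 : E n ≤ (2 / c) * (n * P n) := by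
            rw [hEq]
            calc n * (exp (-(τ n)) / t) = (2 / c) * (n * (c * (exp (-(τ n)) / (2 * t)))) := by
                  field_simp
              _ ≤ _ := by gcongr
          linarith
      · push Not at hτn
        have ht1 : 1 ≤ t := by nlinarith [hn.2.1]
        have h2 : E n ≤ 1 / n := by
          rw [hEq]
          have h3 : exp (-(τ n)) ≤ 1 / n ^ 2 := by
            calc exp (-(τ n)) ≤ exp (-(2 * Real.log n)) := by
                  apply Real.exp_le_exp.2; linarith [hn.2.1]
              _ = 1 / n ^ 2 := by
                  rw [Real.exp_neg, mul_comm, Real.exp_mul, Real.exp_log hn0]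
                  norm_num
          calc n * (exp (-(τ n)) / t) ≤ n * ((1 / n ^ 2) / 1) := by gcongr
            _ = 1 / n := by field_simp
        linarith
    refine squeeze_zero' (Eventually.of_forall hE0) hbound ?_
    simpa using (hnP.const_mul (2 / c)).add hone
  · intro hEn
    have hbound : ∀ᶠ n : ℕ in atTop, n * P n ≤ (exp 9 * 96) * E n + 1 / n := by
      filter_upwards [hreg, hfine] with n hn hf
      have hn1 : (144 : ℝ) ≤ n := by exact_mod_cast hn.1
      have hn0 : (0 : ℝ) < n := by linarith
      have hinv : 0 < 1 / (n : ℝ) := by positivity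
      by_cases hτn : τ n ≤ 6 * Real.log n
      · linarith [(hf hτn).1]
      · push Not at hτn
        have h3 : P n ≤ 1 / n ^ 2 := by
          calc P n ≤ exp (-(τ n / 3)) := aux_crude n (a n) (b n) hn.2.2.1 (hab n) (ha n)
            _ ≤ exp (-(2 * Real.log n)) := by
                  apply Real.exp_le_exp.2; linarith [hn.2.1]
            _ = 1 / n ^ 2 := by
                  rw [Real.exp_neg, mul_comm, Real.exp_mul, Real.exp_log hn0]
                  norm_num
        have h4 : n * P n ≤ 1 / n := by
          calc n * P n ≤ n * (1 / n ^ 2) := by gcongr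
            _ = 1 / n := by field_simp
        have : 0 ≤ (exp 9 * 96) * E n := mul_nonneg (by positivity) (hE0 n)
        linarith
    refine squeeze_zero' (by filter_upwards [hP0] with n hn; positivity) hbound ?_
    simpa using (hEn.const_mul (exp 9 * 96)).add hone

theorem dense_strong_consistency_characterization
    (p q : ℕ → ℝ)
    (hp : ∀ n, 0 ≤ p n ∧ p n ≤ 2 / 3) (hq : ∀ n, 0 ≤ q n ∧ q n ≤ 2 / 3)
    (hne : ∀ n, p n ≠ q n)
    (hp' : Tendsto (fun n : ℕ => (n : ℝ) * p n / (Real.log n) ^ 3) atTop atTop)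
    (hq' : Tendsto (fun n : ℕ => (n : ℝ) * q n / (Real.log n) ^ 3) atTop atTop) :
    Tendsto (fun n : ℕ => (n : ℝ) * Pn n (p n) (q n)) atTop (nhds 0) ↔
    Tendsto (fun n : ℕ =>
      Real.sqrt n * Real.sqrt (p n * (1 - p n) + q n * (1 - q n)) / |p n - q n| *
        Real.exp (-((n : ℝ) * (p n - q n) ^ 2) /
          (2 * (Real.sqrt (p n * (1 - p n) + q n * (1 - q n))) ^ 2)))
      atTop (nhds 0) := by
  have key := aux_main (fun n => max (p n) (q n)) (fun n => min (p n) (q n))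
    (fun n => le_min (hp n).1 (hq n).1) (fun n => min_lt_max.2 (hne n))
    (fun n => max_le (hp n).2 (hq n).2) (by
      have : (fun n : ℕ => (n : ℝ) * min (p n) (q n) / (Real.log n) ^ 3) = fun n : ℕ =>
          min ((n : ℝ) * p n / (Real.log n) ^ 3) ((n : ℝ) * q n / (Real.log n) ^ 3) := by
        funext n
        have h1 : (0 : ℝ) ≤ n := by positivity
        have h2 : 0 ≤ Real.log n ^ 3 := pow_nonneg (Real.log_natCast_nonneg n) 3
        rcases le_total (p n) (q n) with h | h
        · rw [min_eq_left h, min_eq_left (by gcongr)]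
        · rw [min_eq_right h, min_eq_right (by gcongr)]
      rw [this]
      exact tendsto_inf_atTop atTop hp' hq')
  have hfun : (fun n : ℕ =>
      Real.sqrt n * Real.sqrt (p n * (1 - p n) + q n * (1 - q n)) / |p n - q n| *
        Real.exp (-((n : ℝ) * (p n - q n) ^ 2) /
          (2 * (Real.sqrt (p n * (1 - p n) + q n * (1 - q n))) ^ 2))) =
      fun n : ℕ => √n * √(max (p n) (q n) * (1 - max (p n) (q n)) +
          min (p n) (q n) * (1 - min (p n) (q n))) / (max (p n) (q n) - min (p n) (q n)) *
        exp (-((n : ℝ) * (max (p n) (q n) - min (p n) (q n)) ^ 2 /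
          (2 * (max (p n) (q n) * (1 - max (p n) (q n)) +
            min (p n) (q n) * (1 - min (p n) (q n)))))) := by
    funext n
    have hσ : 0 ≤ p n * (1 - p n) + q n * (1 - q n) :=
      add_nonneg (mul_nonneg (hp n).1 (by linarith [(hp n).2]))
        (mul_nonneg (hq n).1 (by linarith [(hq n).2]))
    rw [Real.sq_sqrt hσ, neg_div]
    rcases le_total (p n) (q n) with h | h
    · rw [max_eq_right h, min_eq_left h, abs_of_nonpos (by linarith), neg_sub,
        add_comm (q n * (1 - q n)), ← neg_sub (q n) (p n), neg_sq]
    · rw [max_eq_left h, min_eq_right h, abs_of_nonneg (by linarith)]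
  rw [hfun]
  exact key
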